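/- Let α ∈ (0,1), T > 0, and suppose y : [0,T] → ℝ is nonnegative, integrable, and satisfies the convolved inequality (g_{1−α} * y is in W^{1,1} with vanishing value at 0 and) d/dt(g_{1−α} * y)(t) ≤ C₁ g_{1−α}(t) + C₂ y(t) + h(t) for a.e. t, where C₁, C₂ ≥ 0 and h ∈ L¹(0,T) is nonnegative. Then convolving with g_α yields y(t) ≤ C₁ + C₂ (g_α * y)(t) + (g_α * h)(t) for almost all t ∈ [0,T]. -/

import Mathlib

open MeasureTheory intervalIntegral

/-- Riemann--Liouville kernel `g_β(t) = t^(β-1)/Γ(β)`. -/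
noncomputable def rlKernel (β t : ℝ) : ℝ := t ^ (β - 1) / Real.Gamma β


noncomputable abbrev cv (f g : ℝ → ℝ) : ℝ → ℝ :=
  convolution f g (ContinuousLinearMap.mul ℝ ℝ) volume

noncomputable def cutF (T : ℝ) (f : ℝ → ℝ) : ℝ → ℝ := Set.indicator (Set.Ioc 0 T) f

lemma cutF_of_mem {T t : ℝ} (f : ℝ → ℝ) (h0 : 0 < t) (h1 : t ≤ T) : cutF T f t = f t :=
  Set.indicator_of_mem (Set.mem_Ioc.2 ⟨h0, h1⟩) f

lemma cutF_of_nonpos {T t : ℝ} (f : ℝ → ℝ) (h0 : t ≤ 0) : cutF T f t = 0 :=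
  Set.indicator_of_notMem (fun h => absurd h.1 (not_lt.2 h0)) f

lemma cv_swap (f g : ℝ → ℝ) (t : ℝ) : cv f g t = ∫ s, f (t - s) * g s :=
  convolution_mul_swap

lemma cv_comm (f g : ℝ → ℝ) : cv f g = cv g f := by
  ext t
  rw [cv_swap]
  show _ = ∫ s, g s * f (t - s)
  simp_rw [mul_comm]

lemma cv_cut {T t : ℝ} (k f : ℝ → ℝ) (hf : ∀ s ≤ 0, f s = 0) (h0 : 0 < t) (h1 : t ≤ T) :
    cv (cutF T k) f t = ∫ s in (0:ℝ)..t, k (t - s) * f s := by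
  rw [cv_swap, intervalIntegral.integral_of_le h0.le, integral_Ioc_eq_integral_Ioo,
    ← MeasureTheory.integral_indicator measurableSet_Ioo]
  congr 1
  ext s
  by_cases hs : s ∈ Set.Ioo 0 t
  · rw [Set.indicator_of_mem hs, cutF_of_mem k (by linarith [hs.2]) (by linarith [hs.1])]
  · rw [Set.indicator_of_notMem hs]
    by_cases h : s ≤ 0
    · rw [hf s h, mul_zero]
    · rw [cutF_of_nonpos, zero_mul]
      by_contra h2
      exact hs ⟨by linarith, by linarith⟩

lemma cv_cut_cut {T t : ℝ} (k f : ℝ → ℝ) (h0 : 0 < t) (h1 : t ≤ T) :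
    cv (cutF T k) (cutF T f) t = ∫ s in (0:ℝ)..t, k (t - s) * f s := by
  rw [cv_cut k _ (fun s hs => cutF_of_nonpos f hs) h0 h1]
  apply intervalIntegral.integral_congr_ae
  refine Filter.Eventually.of_forall fun s hs => ?_
  rw [Set.uIoc_of_le h0.le] at hs
  rw [cutF_of_mem f hs.1 (hs.2.trans h1)]

lemma cv_nonpos {T t : ℝ} (k f : ℝ → ℝ) (hf : ∀ s ≤ 0, f s = 0) (h0 : t ≤ 0) :
    cv (cutF T k) f t = 0 := by
  rw [cv_swap]
  apply integral_eq_zero_of_ae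
  refine Filter.Eventually.of_forall fun s => ?_
  by_cases h : s ≤ 0
  · simp [hf s h]
  · simp [cutF_of_nonpos k (show t - s ≤ 0 by linarith)]

lemma cv_congr {T t : ℝ} (k p q : ℝ → ℝ) (hpq : ∀ s ≤ T, p s = q s) (h1 : t ≤ T) :
    cv (cutF T k) p t = cv (cutF T k) q t := by
  rw [cv_swap, cv_swap]
  congr 1
  ext s
  by_cases h : s ≤ T
  · rw [hpq s h]
  · rw [cutF_of_nonpos k (show t - s ≤ 0 by linarith), zero_mul, zero_mul]

lemma cv_assoc {f g k : ℝ → ℝ} (hf : Integrable f) (hg : Integrable g) (hk : Integrable k) :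
    ∀ᵐ t, cv (cv f g) k t = cv f (cv g k) t := by
  have h1 := hf.ae_convolution_exists (ContinuousLinearMap.mul ℝ ℝ) hg
  have h2 := hg.norm.ae_convolution_exists (ContinuousLinearMap.mul ℝ ℝ) hk.norm
  have h3 := hf.norm.ae_convolution_exists (ContinuousLinearMap.mul ℝ ℝ)
    (hg.norm.integrable_convolution (ContinuousLinearMap.mul ℝ ℝ) hk.norm)
  filter_upwards [h3] with t ht
  exact convolution_assoc _ _ _ _ (fun x y z => by simp [mul_assoc]) hf.1 hg.1 hk.1 h1 h2 ht

lemma rl_nonneg {β t : ℝ} (hβ : 0 < β) (ht : 0 ≤ t) : 0 ≤ rlKernel β t :=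
  div_nonneg (Real.rpow_nonneg ht _) (Real.Gamma_pos_of_pos hβ).le

lemma rl_int {β T : ℝ} (hβ : 0 < β) (hT : 0 < T) : Integrable (cutF T (rlKernel β)) := by
  unfold cutF
  rw [integrable_indicator_iff measurableSet_Ioc,
    ← intervalIntegrable_iff_integrableOn_Ioc_of_le hT.le]
  exact (intervalIntegral.intervalIntegrable_rpow' (by linarith)).div_const _

lemma rl_beta {α t : ℝ} (h0 : 0 < α) (h1 : α < 1) (ht : 0 < t) :
    ∫ s in (0:ℝ)..t, rlKernel α (t - s) * rlKernel (1 - α) s = 1 := by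
  have hb := Complex.betaIntegral_scaled ((1 - α : ℝ) : ℂ) (α : ℂ) ht
  have hg := Complex.Gamma_mul_Gamma_eq_betaIntegral (s := ((1 - α : ℝ) : ℂ)) (t := (α : ℂ))
    (by rw [Complex.ofReal_re]; linarith) (by simpa using h0)
  have e : ((1 - α : ℝ) : ℂ) + α = 1 := by push_cast; ring
  rw [e, Complex.Gamma_one, one_mul] at hg
  rw [e, sub_self, Complex.cpow_zero, one_mul, ← hg, Complex.Gamma_ofReal, Complex.Gamma_ofReal]
    at hb
  have hr : ∫ s in (0:ℝ)..t, s ^ ((1 - α) - 1) * (t - s) ^ (α - 1)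
      = Real.Gamma (1 - α) * Real.Gamma α := by
    have : ((∫ s in (0:ℝ)..t, s ^ ((1 - α) - 1) * (t - s) ^ (α - 1) : ℝ) : ℂ)
      = ((Real.Gamma (1 - α) * Real.Gamma α : ℝ) : ℂ) := by
      rw [← intervalIntegral.integral_ofReal, Complex.ofReal_mul, ← hb]
      apply intervalIntegral.integral_congr
      intro s hs
      rw [Set.uIcc_of_le ht.le] at hs
      simp only
      rw [Complex.ofReal_mul, Complex.ofReal_cpow hs.1, Complex.ofReal_cpow (by linarith [hs.2])]
      push_cast
      rfl
    exact_mod_cast this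
  have p1 := (Real.Gamma_pos_of_pos h0).ne'
  have p2 := (Real.Gamma_pos_of_pos (show 0 < 1 - α by linarith)).ne'
  have : ∀ s, rlKernel α (t - s) * rlKernel (1 - α) s
      = (s ^ ((1 - α) - 1) * (t - s) ^ (α - 1)) * (Real.Gamma (1 - α) * Real.Gamma α)⁻¹ := by
    intro s
    unfold rlKernel
    field_simp
  simp_rw [this]
  rw [intervalIntegral.integral_mul_const, hr, mul_inv_cancel₀ (mul_ne_zero p2 p1)]

lemma uniq {T : ℝ} (hT : 0 < T) {p q : ℝ → ℝ} (hp : Integrable p) (hq : Integrable q)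
    (h : ∀ᵐ t, 0 < t → t ≤ T → ∫ s in (0:ℝ)..t, p s = ∫ s in (0:ℝ)..t, q s) :
    ∀ᵐ t, 0 < t → t ≤ T → p t = q t := by
  have hc : Set.EqOn (fun t => ∫ s in (0:ℝ)..t, p s) (fun t => ∫ s in (0:ℝ)..t, q s)
      (Set.Ioo 0 T) := by
    apply Measure.eqOn_open_of_ae_eq (μ := volume) _ isOpen_Ioo
    · exact (intervalIntegral.continuous_primitive (fun a b => hp.intervalIntegrable) 0).continuousOn
    · exact (intervalIntegral.continuous_primitive (fun a b => hq.intervalIntegrable) 0).continuousOn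
    · refine (ae_restrict_iff' measurableSet_Ioo).2 ?_
      filter_upwards [h] with t ht hm
      exact ht hm.1 hm.2.le
  have hne : ∀ᵐ t : ℝ, t ≠ T := by simp [ae_iff, measure_singleton]
  filter_upwards [LocallyIntegrable.ae_hasDerivAt_integral hp.locallyIntegrable,
    LocallyIntegrable.ae_hasDerivAt_integral hq.locallyIntegrable, hne] with t h1 h2 h3 h4 h5
  have hm : Set.Ioo 0 T ∈ nhds t := Ioo_mem_nhds h4 (lt_of_le_of_ne h5 h3)
  exact (h1 0).unique ((h2 0).congr_of_eventuallyEq (hc.eventuallyEq_of_mem hm))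

/-- If `y ≥ 0` is integrable on `[0,T]` and `g_{1−α} * y ∈ W^{1,1}` (with derivative `D` and
vanishing value at `0`) satisfies `d/dt(g_{1−α}*y)(t) ≤ C₁ g_{1−α}(t) + C₂ y(t) + h(t)` a.e.,
then convolving with `g_α` yields `y(t) ≤ C₁ + C₂ (g_α*y)(t) + (g_α*h)(t)` a.e. -/
theorem convolve_fractional_inequality
    (T α : ℝ) (hT : 0 < T) (hα0 : 0 < α) (hα1 : α < 1)
    (C₁ C₂ : ℝ) (hC₁ : 0 ≤ C₁) (hC₂ : 0 ≤ C₂)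
    (y h : ℝ → ℝ)
    (hy0 : ∀ t, 0 ≤ y t) (hyInt : IntegrableOn y (Set.Icc 0 T))
    (hh0 : ∀ t, 0 ≤ h t) (hhInt : IntegrableOn h (Set.Icc 0 T))
    -- `g_{1−α} * y ∈ W^{1,1}(0,T)` with derivative `D` and value `0` at `t = 0`
    (D : ℝ → ℝ) (hDInt : IntegrableOn D (Set.Icc 0 T))
    (hK : ∀ t ∈ Set.Icc (0:ℝ) T,
      (∫ s in (0:ℝ)..t, rlKernel (1 - α) (t - s) * y s) = ∫ s in (0:ℝ)..t, D s)
    (hDle : ∀ᵐ t ∂(volume.restrict (Set.Ioc (0:ℝ) T)),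
      D t ≤ C₁ * rlKernel (1 - α) t + C₂ * y t + h t) :
    ∀ᵐ t ∂(volume.restrict (Set.Ioc (0:ℝ) T)),
      y t ≤ C₁ + C₂ * (∫ s in (0:ℝ)..t, rlKernel α (t - s) * y s)
        + ∫ s in (0:ℝ)..t, rlKernel α (t - s) * h s := by
  have hcut : ∀ {f : ℝ → ℝ}, IntegrableOn f (Set.Icc 0 T) → Integrable (cutF T f) := fun hf =>
    (integrable_indicator_iff measurableSet_Ioc).2 (hf.mono_set Set.Ioc_subset_Icc_self)
  have iY := hcut hyInt
  have iH := hcut hhInt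
  have iD := hcut hDInt
  have ia := rl_int hα0 hT
  have ib := rl_int (show 0 < 1 - α by linarith) hT
  have iu : Integrable (cutF T (fun _ => (1:ℝ))) := hcut (integrableOn_const (by simp))
  have iaD : Integrable (cv (cutF T (rlKernel α)) (cutF T D)) :=
    ia.integrable_convolution (ContinuousLinearMap.mul ℝ ℝ) iD
  have z : ∀ f : ℝ → ℝ, ∀ s ≤ 0, cutF T f s = 0 := fun f s hs => cutF_of_nonpos f hs
  -- first identity
  have e1 : ∀ s ≤ T, cv (cutF T (rlKernel (1 - α))) (cutF T y) s
      = cv (cutF T (fun _ => (1:ℝ))) (cutF T D) s := by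
    intro s hs
    by_cases h0 : 0 < s
    · rw [cv_cut_cut _ _ h0 hs, cv_cut_cut _ _ h0 hs, hK s ⟨h0.le, hs⟩]
      simp
    · rw [cv_nonpos _ _ (z _) (not_lt.1 h0), cv_nonpos _ _ (z _) (not_lt.1 h0)]
  have e2 : ∀ s ≤ T, cv (cutF T (rlKernel α)) (cutF T (rlKernel (1 - α))) s
      = cutF T (fun _ => (1:ℝ)) s := by
    intro s hs
    by_cases h0 : 0 < s
    · rw [cv_cut_cut _ _ h0 hs, rl_beta hα0 hα1 h0, cutF_of_mem _ h0 hs]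
    · rw [cv_nonpos _ _ (z _) (not_lt.1 h0), z _ _ (not_lt.1 h0)]
  have e3 : ∀ᵐ t, 0 < t → t ≤ T → ∫ s in (0:ℝ)..t, cutF T y s
      = ∫ s in (0:ℝ)..t, cv (cutF T (rlKernel α)) (cutF T D) s := by
    filter_upwards [cv_assoc ia ib iY, cv_assoc ia iu iD, cv_assoc iu ia iD] with t h1 h2 h3 h4 h5
    have a1 := cv_cut (fun _ => (1:ℝ)) (cutF T y) (z _) h4 h5
    have a2 := cv_cut (fun _ => (1:ℝ)) (cv (cutF T (rlKernel α)) (cutF T D))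
      (fun s hs => cv_nonpos _ _ (z _) hs) h4 h5
    simp only [one_mul] at a1 a2
    rw [← a1, ← a2, ← h3, cv_comm (cutF T (fun _ => (1:ℝ))) (cutF T (rlKernel α)), h2,
      ← cv_congr _ _ _ e1 h5, ← h1, cv_comm _ (cutF T y), cv_comm _ (cutF T y)]
    exact (cv_congr _ _ _ e2 h5).symm
  have e4 := uniq hT iY iaD e3
  have hD' : ∀ᵐ s, cutF T D s ≤ C₁ * cutF T (rlKernel (1 - α)) s + C₂ * cutF T y s
      + cutF T h s := by
    filter_upwards [(ae_restrict_iff' measurableSet_Ioc).1 hDle] with s hs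
    by_cases hm : s ∈ Set.Ioc 0 T
    · simp only [cutF, Set.indicator_of_mem hm]
      exact hs hm
    · simp [cutF, Set.indicator_of_notMem hm]
  rw [ae_restrict_iff' measurableSet_Ioc]
  filter_upwards [e4, ia.ae_convolution_exists (ContinuousLinearMap.mul ℝ ℝ) iD,
    ia.ae_convolution_exists (ContinuousLinearMap.mul ℝ ℝ) ib,
    ia.ae_convolution_exists (ContinuousLinearMap.mul ℝ ℝ) iY,
    ia.ae_convolution_exists (ContinuousLinearMap.mul ℝ ℝ) iH] with t h1 xD xb xY xH ht
  have jD := xD.integrable_swap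
  have jb := xb.integrable_swap
  have jY := xY.integrable_swap
  have jH := xH.integrable_swap
  simp only [ContinuousLinearMap.mul_apply'] at jD jb jY jH
  have k1 := h1 ht.1 ht.2
  rw [cutF_of_mem _ ht.1 ht.2] at k1
  rw [k1, ← cv_cut_cut _ _ ht.1 ht.2, ← cv_cut_cut _ _ ht.1 ht.2]
  have k2 := e2 t ht.2
  rw [cutF_of_mem _ ht.1 ht.2] at k2
  rw [cv_swap] at k2
  rw [cv_swap, cv_swap, cv_swap]
  calc _ ≤ ∫ s, (C₁ * (cutF T (rlKernel α) (t - s) * cutF T (rlKernel (1 - α)) s)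
        + C₂ * (cutF T (rlKernel α) (t - s) * cutF T y s)
        + cutF T (rlKernel α) (t - s) * cutF T h s) := by
        apply integral_mono_ae jD (((jb.const_mul _).add (jY.const_mul _)).add jH)
        filter_upwards [hD'] with s hs
        have hn : 0 ≤ cutF T (rlKernel α) (t - s) :=
          Set.indicator_nonneg (fun x hx => rl_nonneg hα0 hx.1.le) _
        have := mul_le_mul_of_nonneg_left hs hn
        simp only [Pi.add_apply]
        linarith
    _ = _ := by
        have q1 := MeasureTheory.integral_add ((jb.const_mul C₁).add (jY.const_mul C₂)) jH
        have q2 := MeasureTheory.integral_add (jb.const_mul C₁) (jY.const_mul C₂)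
        simp only [Pi.add_apply] at q1
        rw [q1, q2, MeasureTheory.integral_const_mul, MeasureTheory.integral_const_mul,
          k2, mul_one]
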